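/- Let Q be an affine monoid, let F ⊆ G be faces of Q and let m ∈ gp(Q). Then gp(G) + m is a family of holes of Q if and only if gp(G) + m is a family of holes of the localization Q_F (which is itself an affine monoid with gp(Q_F) = gp(Q)). In particular, the families of holes of Q_F are exactly those families of holes gp(G) + q of Q whose face G contains F. -/

import Mathlib

open scoped Pointwise

/-- The lattice `ℤ^N`. -/
abbrev ZN (N : ℕ) : Type := Fin N → ℤ

/-- The subgroup of `ℤ^N` generated by a submonoid `Q`, i.e. `gp(Q)`. -/
def gp {N : ℕ} (Q : AddSubmonoid (ZN N)) : AddSubgroup (ZN N) :=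
  AddSubgroup.closure (Q : Set (ZN N))

/-- `F` is a face of the monoid `Q`. -/
def IsFace {N : ℕ} (Q F : AddSubmonoid (ZN N)) : Prop :=
  F ≤ Q ∧ ∀ a b : ZN N, a ∈ Q → b ∈ Q → (a + b ∈ F ↔ a ∈ F ∧ b ∈ F)

/-- The normalization (saturation) `sat(Q)` of `Q`:
all `q ∈ gp(Q)` such that `n • q ∈ Q` for some `n ≥ 1`. -/
def sat {N : ℕ} (Q : AddSubmonoid (ZN N)) : AddSubmonoid (ZN N) where
  carrier := {q | q ∈ gp Q ∧ ∃ n : ℕ, 1 ≤ n ∧ n • q ∈ Q}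
  zero_mem' := ⟨(gp Q).zero_mem, 1, le_refl 1, by simpa using Q.zero_mem⟩
  add_mem' := by
    rintro a b ⟨ha, n, hn, hna⟩ ⟨hb, m, hm, hmb⟩
    refine ⟨(gp Q).add_mem ha hb, n * m,
      Nat.one_le_iff_ne_zero.mpr (Nat.mul_ne_zero (by omega) (by omega)), ?_⟩
    have h1 : (n * m) • a ∈ Q := by
      rw [mul_comm, mul_smul]; exact AddSubmonoid.nsmul_mem Q hna m
    have h2 : (n * m) • b ∈ Q := by
      rw [mul_smul]; exact AddSubmonoid.nsmul_mem Q hmb n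
    rw [smul_add]; exact Q.add_mem h1 h2

/-- `Q` is contained in its normalization. -/
theorem le_sat {N : ℕ} (Q : AddSubmonoid (ZN N)) : Q ≤ sat Q := fun q hq =>
  ⟨AddSubgroup.subset_closure hq, 1, le_refl 1, by simpa using hq⟩

/-- The set of holes `sat(Q) ∖ Q`. -/
def holes {N : ℕ} (Q : AddSubmonoid (ZN N)) : Set (ZN N) :=
  (sat Q : Set (ZN N)) \ (Q : Set (ZN N))

/-- The localization `Q_F = {q - f : q ∈ Q, f ∈ F}`. -/
def loc {N : ℕ} (Q F : AddSubmonoid (ZN N)) : AddSubmonoid (ZN N) where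
  carrier := {x | ∃ q ∈ Q, ∃ f ∈ F, x = q - f}
  zero_mem' := ⟨0, Q.zero_mem, 0, F.zero_mem, by simp⟩
  add_mem' := by
    rintro a b ⟨q, hq, f, hf, rfl⟩ ⟨q', hq', f', hf', rfl⟩
    exact ⟨q + q', Q.add_mem hq hq', f + f', F.add_mem hf hf', by ring⟩

/-- `F` is a maximal face (w.r.t. inclusion) among the faces `G` of `Q` with
`G + m ⊆ D`. -/
def IsMaxFaceFor {N : ℕ} (Q : AddSubmonoid (ZN N)) (D : Set (ZN N))
    (F : AddSubmonoid (ZN N)) (m : ZN N) : Prop :=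
  IsFace Q F ∧ (∀ f ∈ F, f + m ∈ D) ∧
    ∀ G : AddSubmonoid (ZN N), IsFace Q G → (∀ g ∈ G, g + m ∈ D) → F ≤ G → G = F

/-- `gp(F) + q` is a family of holes of `Q` (with the face `F` and base point `q`). -/
def IsFamilyOfHolesWith {N : ℕ} (Q F : AddSubmonoid (ZN N)) (q : ZN N) : Prop :=
  q ∈ holes Q ∧ IsMaxFaceFor Q (holes Q) F q

/-- `S ⊆ gp(Q)` is a family of holes of `Q`. -/
def IsFamilyOfHoles {N : ℕ} (Q : AddSubmonoid (ZN N)) (S : Set (ZN N)) : Prop :=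
  ∃ (q : ZN N) (F : AddSubmonoid (ZN N)), IsFamilyOfHolesWith Q F q ∧
    S = (fun f => f + q) '' (gp F : Set (ZN N))

/-- `M ⊆ gp(Q)` is a `Q`-module. -/
def IsQModule {N : ℕ} (Q : AddSubmonoid (ZN N)) (M : Set (ZN N)) : Prop :=
  M ⊆ (gp Q : Set (ZN N)) ∧ ∀ q ∈ Q, ∀ m ∈ M, q + m ∈ M

/-- `M` is a finitely generated `Q`-module: a finite union of translates of `Q`. -/
def IsFGQModule {N : ℕ} (Q : AddSubmonoid (ZN N)) (M : Set (ZN N)) : Prop :=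
  IsQModule Q M ∧ ∃ s : Finset (ZN N), ↑s ⊆ M ∧
    M = ⋃ m ∈ s, {x | ∃ q ∈ Q, x = m + q}

/-- The rank of a subgroup of `ℤ^N`. -/
noncomputable def rk {N : ℕ} (A : AddSubgroup (ZN N)) : ℕ :=
  Module.finrank ℤ (AddSubgroup.toIntSubmodule A)

/-- The face `F₀` of units of `Q`. -/
def unitsFace {N : ℕ} (Q : AddSubmonoid (ZN N)) : AddSubmonoid (ZN N) where
  carrier := {q | q ∈ Q ∧ -q ∈ Q}
  zero_mem' := ⟨Q.zero_mem, by simpa using Q.zero_mem⟩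
  add_mem' := by
    rintro a b ⟨ha, ha'⟩ ⟨hb, hb'⟩
    exact ⟨Q.add_mem ha hb, by rw [neg_add]; exact Q.add_mem ha' hb'⟩

/-- The *dimension of a face `F` of `Q`: `rank gp(F) - rank gp(F₀)`. -/
noncomputable def sdim {N : ℕ} (Q F : AddSubmonoid (ZN N)) : ℕ :=
  rk (gp F) - rk (gp (unitsFace Q))

/-- The *dimension of `Q`: `rank gp(Q) - rank gp(F₀)`. -/
noncomputable def sdimQ {N : ℕ} (Q : AddSubmonoid (ZN N)) : ℕ :=
  rk (gp Q) - rk (gp (unitsFace Q))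

/-- `Q` is seminormal: `2q, 3q ∈ Q` implies `q ∈ Q` for `q ∈ gp(Q)`. -/
def Seminormal {N : ℕ} (Q : AddSubmonoid (ZN N)) : Prop :=
  ∀ q ∈ gp Q, (2 : ℕ) • q ∈ Q → (3 : ℕ) • q ∈ Q → q ∈ Q

/-- The canonical embedding `ℤ^N → ℚ^N`. -/
def toQ {N : ℕ} (x : ZN N) : Fin N → ℚ := fun i => (x i : ℚ)

/-- The `ℚ`-linear span of (the image in `ℚ^N` of) a submonoid `F` of `ℤ^N`. -/
def qspan {N : ℕ} (F : AddSubmonoid (ZN N)) : Submodule ℚ (Fin N → ℚ) :=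
  Submodule.span ℚ (toQ '' (F : Set (ZN N)))

theorem le_loc {N : ℕ} (Q F : AddSubmonoid (ZN N)) : Q ≤ loc Q F := fun q hq =>
  ⟨q, hq, 0, F.zero_mem, by simp⟩

theorem neg_mem_loc {N : ℕ} (Q : AddSubmonoid (ZN N)) {F : AddSubmonoid (ZN N)} {f : ZN N}
    (hf : f ∈ F) : -f ∈ loc Q F :=
  ⟨0, Q.zero_mem, f, hf, by simp⟩

theorem gp_mono {N : ℕ} {P Q : AddSubmonoid (ZN N)} (h : P ≤ Q) : gp P ≤ gp Q :=
  AddSubgroup.closure_mono h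

theorem gp_loc {N : ℕ} {Q F : AddSubmonoid (ZN N)} (h : F ≤ Q) : gp (loc Q F) = gp Q := by
  refine le_antisymm ((AddSubgroup.closure_le _).2 ?_) (gp_mono (le_loc Q F))
  rintro _ ⟨q, hq, f, hf, rfl⟩
  exact sub_mem (AddSubgroup.subset_closure hq) (AddSubgroup.subset_closure (h hf))

theorem exists_sub_of_mem_gp {N : ℕ} {Q : AddSubmonoid (ZN N)} {x : ZN N} (hx : x ∈ gp Q) :
    ∃ a ∈ Q, ∃ b ∈ Q, x = a - b := by
  induction hx using AddSubgroup.closure_induction with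
  | mem x hx => exact ⟨x, hx, 0, Q.zero_mem, by simp⟩
  | zero => exact ⟨0, Q.zero_mem, 0, Q.zero_mem, by simp⟩
  | add x y _ _ hx hy => exact (loc Q Q).add_mem hx hy
  | neg x _ hx =>
    obtain ⟨a, ha, b, hb, rfl⟩ := hx
    exact ⟨b, hb, a, ha, by simp⟩

/-- A face is recovered from the subgroup it generates. -/
theorem IsFace.mem_of_mem_gp {N : ℕ} {Q G : AddSubmonoid (ZN N)} (hG : IsFace Q G) {x : ZN N}
    (hx : x ∈ Q) (hxG : x ∈ gp G) : x ∈ G := by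
  obtain ⟨a, ha, b, hb, rfl⟩ := exists_sub_of_mem_gp hxG
  exact ((hG.2 _ b hx (hG.1 hb)).1 (by simpa using ha)).1

theorem IsFace.eq_of_gp_eq {N : ℕ} {Q G H : AddSubmonoid (ZN N)} (hG : IsFace Q G)
    (hH : IsFace Q H) (h : gp G = gp H) : G = H :=
  le_antisymm
    (fun _ hx => hH.mem_of_mem_gp (hG.1 hx) (h ▸ AddSubgroup.subset_closure hx))
    (fun _ hx => hG.mem_of_mem_gp (hH.1 hx) (h ▸ AddSubgroup.subset_closure hx))

theorem eq_of_image_add_eq {N : ℕ} {A B : AddSubgroup (ZN N)} {x y : ZN N}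
    (h : (fun f => f + x) '' (A : Set (ZN N)) = (fun f => f + y) '' (B : Set (ZN N))) :
    A = B := by
  have key : ∀ {A B : AddSubgroup (ZN N)} {x y : ZN N},
      (fun f => f + x) '' (A : Set (ZN N)) = (fun f => f + y) '' (B : Set (ZN N)) → A ≤ B := by
    intro A B x y h a ha
    obtain ⟨b, hb, hbx⟩ : a + x ∈ (fun f => f + y) '' (B : Set (ZN N)) := h ▸ ⟨a, ha, rfl⟩
    obtain ⟨c, hc, hcx⟩ : x ∈ (fun f => f + y) '' (B : Set (ZN N)) :=
      h ▸ ⟨0, A.zero_mem, zero_add x⟩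
    have hac : a = b - c := by
      simp only at hbx hcx
      rw [eq_sub_iff_add_eq, ← add_left_inj y, hbx, add_assoc, hcx]
    exact hac ▸ sub_mem hb hc
  exact le_antisymm (key h) (key h.symm)

theorem image_add_eq_of_mem {N : ℕ} (A : AddSubgroup (ZN N)) (x : ZN N) {a : ZN N} (ha : a ∈ A) :
    (fun f => f + (x + a)) '' (A : Set (ZN N)) = (fun f => f + x) '' (A : Set (ZN N)) := by
  ext y
  constructor
  · rintro ⟨b, hb, rfl⟩
    exact ⟨b + a, A.add_mem hb ha, by simp only; abel⟩
  · rintro ⟨b, hb, rfl⟩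
    exact ⟨b - a, A.sub_mem hb ha, by simp only; abel⟩

theorem IsFace.loc {N : ℕ} {Q F K : AddSubmonoid (ZN N)} (hK : IsFace Q K) (hFK : F ≤ K) :
    IsFace (loc Q F) (loc K F) := by
  constructor
  · rintro _ ⟨k, hk, f, hf, rfl⟩
    exact ⟨k, hK.1 hk, f, hf, rfl⟩
  · rintro _ _ ⟨p, hp, f, hf, rfl⟩ ⟨p', hp', f', hf', rfl⟩
    refine ⟨?_, fun h => add_mem h.1 h.2⟩
    rintro ⟨k, hk, g, hg, h⟩
    have hsum : (p + p') + g = k + (f + f') := by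
      rw [eq_sub_iff_add_eq] at h
      rw [← h]
      abel
    have hmem : (p + p') + g ∈ K := hsum ▸ add_mem hk (hFK (add_mem hf hf'))
    have h2 := (hK.2 p p' hp hp').1
      ((hK.2 _ g (add_mem hp hp') (hK.1 (hFK hg))).1 hmem).1
    exact ⟨⟨p, h2.1, f, hf, rfl⟩, ⟨p', h2.2, f', hf', rfl⟩⟩

theorem IsFace.inf_of_le {N : ℕ} {P Q H : AddSubmonoid (ZN N)} (hH : IsFace P H) (hQ : Q ≤ P) :
    IsFace Q (H ⊓ Q) := by
  refine ⟨inf_le_right, fun a b ha hb => ?_⟩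
  simp only [AddSubmonoid.mem_inf, hH.2 a b (hQ ha) (hQ hb), ha, hb, add_mem ha hb, and_true]

theorem IsFace.mem_and_neg_mem {N : ℕ} {Q F H : AddSubmonoid (ZN N)} (hFQ : F ≤ Q)
    (hH : IsFace (_root_.loc Q F) H) {f : ZN N} (hf : f ∈ F) : f ∈ H ∧ -f ∈ H :=
  (hH.2 f (-f) (le_loc Q F (hFQ hf)) (neg_mem_loc Q hf)).1 (by simp)

theorem IsFace.loc_inf {N : ℕ} {Q F H : AddSubmonoid (ZN N)} (hFQ : F ≤ Q)
    (hH : IsFace (_root_.loc Q F) H) : _root_.loc (H ⊓ Q) F = H := by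
  apply le_antisymm
  · rintro _ ⟨q, hq, f, hf, rfl⟩
    rw [sub_eq_add_neg]
    exact add_mem hq.1 (hH.mem_and_neg_mem hFQ hf).2
  · intro x hx
    obtain ⟨q, hq, f, hf, rfl⟩ := hH.1 hx
    exact ⟨q, ⟨by simpa using add_mem hx (hH.mem_and_neg_mem hFQ hf).1, hq⟩, f, hf, rfl⟩

theorem IsFace.loc_inf_self {N : ℕ} {Q F K : AddSubmonoid (ZN N)} (hK : IsFace Q K)
    (hFK : F ≤ K) : _root_.loc K F ⊓ Q = K := by
  apply le_antisymm
  · rintro x ⟨hx, hxQ⟩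
    refine hK.mem_of_mem_gp hxQ ?_
    rw [← gp_loc hFK]
    exact AddSubgroup.subset_closure hx
  · exact fun x hx => ⟨le_loc K F hx, hK.1 hx⟩

theorem sat_mono {N : ℕ} {P Q : AddSubmonoid (ZN N)} (h : P ≤ Q) : sat P ≤ sat Q :=
  fun _ ⟨hx, n, hn, hnx⟩ => ⟨gp_mono h hx, n, hn, h hnx⟩

theorem exists_add_mem_sat {N : ℕ} {Q F : AddSubmonoid (ZN N)} (hFQ : F ≤ Q) {x : ZN N}
    (hx : x ∈ sat (loc Q F)) : ∃ f ∈ F, x + f ∈ sat Q := by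
  obtain ⟨hxg, n, hn, q, hq, f, hf, h⟩ := hx
  obtain ⟨k, rfl⟩ := Nat.exists_eq_add_of_le' hn
  refine ⟨f, hf, ?_, k + 1, hn, ?_⟩
  · rw [gp_loc hFQ] at hxg
    exact add_mem hxg (AddSubgroup.subset_closure (hFQ hf))
  · have hk : (k + 1) • (x + f) = q + k • f := by
      rw [smul_add, h, succ_nsmul]
      abel
    exact hk ▸ add_mem hq (nsmul_mem (hFQ hf) k)

theorem add_mem_holes_loc {N : ℕ} {Q F K : AddSubmonoid (ZN N)} (hKQ : K ≤ Q) (hFK : F ≤ K)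
    {q : ZN N} (h : ∀ k ∈ K, k + q ∈ holes Q) :
    ∀ k ∈ loc K F, k + q ∈ holes (loc Q F) := by
  rintro _ ⟨k, hk, f, hf, rfl⟩
  constructor
  · have hsum : k - f + q = (k + q) + -f := by abel
    rw [hsum]
    exact add_mem (sat_mono (le_loc Q F) (h k hk).1) (le_sat _ (neg_mem_loc Q hf))
  · rintro ⟨p, hp, g, hg, hpg⟩
    refine (h (k + g) (add_mem hk (hFK hg))).2 ?_
    have hsum : k + g + q = p + f := by
      rw [eq_sub_iff_add_eq] at hpg
      rw [← hpg]
      abel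
    rw [hsum]
    exact add_mem hp (hKQ (hFK hf))

theorem add_mem_holes_of_loc {N : ℕ} {Q F H : AddSubmonoid (ZN N)} {q : ZN N} (hq : q ∈ sat Q)
    (h : ∀ k ∈ H, k + q ∈ holes (loc Q F)) : ∀ k ∈ H ⊓ Q, k + q ∈ holes Q :=
  fun k hk => ⟨add_mem (le_sat Q hk.2) hq, fun hkq => (h k hk.1).2 (le_loc Q F hkq)⟩

theorem IsFamilyOfHolesWith.loc {N : ℕ} {Q F G : AddSubmonoid (ZN N)} {q : ZN N} (hFG : F ≤ G)
    (h : IsFamilyOfHolesWith Q G q) : IsFamilyOfHolesWith (loc Q F) (loc G F) q := by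
  obtain ⟨hq, hG, hGq, hmax⟩ := h
  have hFQ : F ≤ Q := hFG.trans hG.1
  have hGq' := add_mem_holes_loc hG.1 hFG hGq
  refine ⟨by simpa using hGq' 0 (zero_mem _), hG.loc hFG, hGq', fun H hH hHq hGH => ?_⟩
  rw [← hH.loc_inf hFQ, hmax (H ⊓ Q) (hH.inf_of_le (le_loc Q F))
    (add_mem_holes_of_loc hq.1 hHq) fun x hx => ⟨hGH (le_loc G F hx), hG.1 hx⟩]

theorem IsFamilyOfHolesWith.of_loc {N : ℕ} {Q F H : AddSubmonoid (ZN N)} {q : ZN N}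
    (hFQ : F ≤ Q) (hq : q ∈ sat Q) (h : IsFamilyOfHolesWith (_root_.loc Q F) H q) :
    IsFamilyOfHolesWith Q (H ⊓ Q) q := by
  obtain ⟨-, hH, hHq, hmax⟩ := h
  have hHq' := add_mem_holes_of_loc hq hHq
  refine ⟨by simpa using hHq' 0 (zero_mem _), hH.inf_of_le (le_loc Q F), hHq',
    fun K hK hKq hle => ?_⟩
  have hFK : F ≤ K := fun f hf => hle ⟨(hH.mem_and_neg_mem hFQ hf).1, hFQ hf⟩
  have hKH : _root_.loc K F = H := by
    refine hmax _ (hK.loc hFK) (add_mem_holes_loc hK.1 hFK hKq) ?_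
    rw [← hH.loc_inf hFQ]
    rintro _ ⟨x, hx, f, hf, rfl⟩
    exact ⟨x, hle hx, f, hf, rfl⟩
  rw [← hKH, hK.loc_inf_self hFK]

/-- The base point of a family of holes may be moved by a unit of its face. -/
theorem IsFamilyOfHolesWith.add_unit {N : ℕ} {P H : AddSubmonoid (ZN N)} {q u : ZN N}
    (hu : u ∈ H) (hu' : -u ∈ H) (h : IsFamilyOfHolesWith P H q) :
    IsFamilyOfHolesWith P H (q + u) := by
  obtain ⟨-, hH, hHq, hmax⟩ := h
  refine ⟨add_comm u q ▸ hHq u hu, hH, fun x hx => ?_, fun K hK hKq hle => ?_⟩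
  · have hsum : x + (q + u) = x + u + q := by abel
    exact hsum ▸ hHq _ (add_mem hx hu)
  · refine hmax K hK (fun x hx => ?_) hle
    have hsum : x + q = x + -u + (q + u) := by abel
    exact hsum ▸ hKq _ (add_mem hx (hle hu'))

theorem isFamilyOfHoles_loc_iff {N : ℕ} {Q F : AddSubmonoid (ZN N)} (hFQ : F ≤ Q)
    (S : Set (ZN N)) : IsFamilyOfHoles (loc Q F) S ↔
      ∃ (q : ZN N) (G : AddSubmonoid (ZN N)), IsFace Q G ∧ F ≤ G ∧
        IsFamilyOfHolesWith Q G q ∧ S = (fun f => f + q) '' (gp G : Set (ZN N)) := by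
  constructor
  · rintro ⟨q, H, h, rfl⟩
    obtain ⟨f, hf, hqf⟩ := exists_add_mem_sat hFQ h.1.1
    have hH : IsFace (loc Q F) H := h.2.1
    obtain ⟨hfH, hfH'⟩ := hH.mem_and_neg_mem hFQ hf
    have hFG : F ≤ H ⊓ Q := fun x hx => ⟨(hH.mem_and_neg_mem hFQ hx).1, hFQ hx⟩
    refine ⟨q + f, H ⊓ Q, hH.inf_of_le (le_loc Q F), hFG, (h.add_unit hfH hfH').of_loc hFQ hqf, ?_⟩
    rw [← gp_loc hFG, hH.loc_inf hFQ, image_add_eq_of_mem (gp H) q (AddSubgroup.subset_closure hfH)]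
  · rintro ⟨q, G, -, hFG, h, rfl⟩
    exact ⟨q, loc G F, h.loc hFG, by rw [gp_loc hFG]⟩

/-- For faces `F ⊆ G` of `Q` and `m ∈ gp(Q)`, the set `gp(G) + m` is a
family of holes of `Q` iff it is a family of holes of the localization `Q_F`; and the
families of holes of `Q_F` are exactly the families of holes `gp(G') + q` of `Q` whose
face `G'` contains `F`. -/
theorem familyOfHoles_loc {N : ℕ} (Q F G : AddSubmonoid (ZN N)) (hQ : Q.FG)
    (hF : IsFace Q F) (hG : IsFace Q G) (hFG : F ≤ G) (m : ZN N) (hm : m ∈ gp Q) :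
    (IsFamilyOfHoles Q ((fun f => f + m) '' (gp G : Set (ZN N))) ↔
      IsFamilyOfHoles (loc Q F) ((fun f => f + m) '' (gp G : Set (ZN N)))) ∧
    (∀ S : Set (ZN N), IsFamilyOfHoles (loc Q F) S ↔
      ∃ (q : ZN N) (G' : AddSubmonoid (ZN N)), IsFace Q G' ∧ F ≤ G' ∧
        IsFamilyOfHolesWith Q G' q ∧
        S = (fun f => f + q) '' (gp G' : Set (ZN N))) := by
  refine ⟨⟨?_, fun h => ?_⟩, isFamilyOfHoles_loc_iff hF.1⟩
  · rintro ⟨q, G', h, hS⟩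
    obtain rfl : G = G' := hG.eq_of_gp_eq h.2.1 (eq_of_image_add_eq hS)
    exact (isFamilyOfHoles_loc_iff hF.1 _).2 ⟨q, G, hG, hFG, h, hS⟩
  · obtain ⟨q, G', -, -, h', hS⟩ := (isFamilyOfHoles_loc_iff hF.1 _).1 h
    exact ⟨q, G', h', hS⟩
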